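/- arXiv:1511.07274 — 2 statements merged into one kernel-verified Lean document; each statement's English description precedes it below -/
import Mathlib

section
/- Let T be a tree with t ≥ 1 edges, with vertices ordered in a good labeling x_1, x_2, …, x_{t+1} with parent function f (so x_1 is a leaf and for each j > 1, f(j) is the unique index with f(j) < j and x_j x_{f(j)} ∈ E(T)). Let G be a finite graph with minimum degree at least t, and let Ω be the set of labeled copies of T in G. Then for every vertex v of G and every index i with 1 ≤ i ≤ t + 1, ∑_{φ ∈ Ω, φ(x_i) = v} ∏_{j=2}^{t} (d(φ(x_{f(j+1)})) − t + 1)^{−1} ≥ d(v), where d(·) denotes degree in G. -/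
open Classical in
/-- The weight of a map `φ` from the vertices of `T`, in which a vertex `u` contributes
`W (φ u) ^ (1 - deg u)`; in this form it does not depend on a choice of root. -/
noncomputable def treeWeight {U V : Type*} [Fintype U] (T : SimpleGraph U) (W : V → ℝ)
    (φ : U → V) : ℝ :=
  (∏ u, W (φ u)) * ∏ u, ∏ w, if T.Adj u w then (W (φ u))⁻¹ else 1

/-- `φ` is a labeled copy of `T` in `G` that sends `r` to `v`. -/
def IsRootedCopy {U V : Type*} (T : SimpleGraph U) (G : SimpleGraph V) (r : U) (v : V)
    (φ : U → V) : Prop :=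
  Function.Injective φ ∧ (∀ u w : U, T.Adj u w → G.Adj (φ u) (φ w)) ∧ φ r = v

theorem treeWeight_pos {U V : Type*} [Fintype U] (T : SimpleGraph U) {W : V → ℝ}
    (hW : ∀ a, 0 < W a) (φ : U → V) : 0 < treeWeight T W φ := by
  refine mul_pos (Finset.prod_pos fun u _ => hW _)
    (Finset.prod_pos fun u _ => Finset.prod_pos fun w _ => ?_)
  split_ifs
  · exact inv_pos.2 (hW _)
  · exact one_pos

section Leaf

variable {U V : Type*} [DecidableEq U] {T : SimpleGraph U} {l p : U}

theorem treeWeight_extend_leaf [Fintype U] {W : V → ℝ} (hW : ∀ a, 0 < W a) (hlp : p ≠ l)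
    (hl : ∀ w, T.Adj l w ↔ w = p) (a : V) (ψ : {u // u ≠ l} → V) :
    treeWeight T W ((Equiv.funSplitAt l V).symm (a, ψ)) =
      treeWeight (T.induce {u | u ≠ l}) W ψ * (W (ψ ⟨p, hlp⟩))⁻¹ := by
  classical
  have hl' : ∀ w, T.Adj w l ↔ w = p := fun w => by rw [T.adj_comm, hl]
  have hext : ∀ u : {u // u ≠ l}, (Equiv.funSplitAt l V).symm (a, ψ) u = ψ u := fun u => by
    simp [Equiv.funSplitAt_symm_apply, u.2]
  have hextl : (Equiv.funSplitAt l V).symm (a, ψ) l = a := by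
    simp [Equiv.funSplitAt_symm_apply]
  have hp : ∏ u : {u // u ≠ l}, (if (u : U) = p then (W (ψ u))⁻¹ else 1) =
      (W (ψ ⟨p, hlp⟩))⁻¹ := by
    rw [Finset.prod_eq_single ⟨p, hlp⟩]
    · simp
    · intro b _ hb
      rw [if_neg fun h => hb (Subtype.ext h)]
    · simp
  have ha : W a ≠ 0 := (hW a).ne'
  unfold treeWeight
  rw [Fintype.prod_eq_mul_prod_subtype_ne _ l,
    Fintype.prod_eq_mul_prod_subtype_ne (fun u => ∏ w, if T.Adj u w then _ else _) l]
  simp only [hext, hextl, hl, Finset.prod_ite_eq', Finset.mem_univ, if_true]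
  have : ∀ u : {u // u ≠ l}, (∏ w, if T.Adj u w then (W (ψ u))⁻¹ else 1) =
      (if (u : U) = p then (W (ψ u))⁻¹ else 1) *
        ∏ w : {u // u ≠ l}, if T.Adj u w then (W (ψ u))⁻¹ else 1 := fun u => by
    rw [Fintype.prod_eq_mul_prod_subtype_ne _ l]
    simp only [hl']
  simp only [this, Finset.prod_mul_distrib, hp, SimpleGraph.comap_adj,
    Function.Embedding.subtype_apply]
  field_simp
  rfl

theorem isRootedCopy_extend_leaf {G : SimpleGraph V} {r : U} {v : V} (hlp : p ≠ l) (hrl : r ≠ l)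
    (hl : ∀ w, T.Adj l w ↔ w = p) (a : V) (ψ : {u // u ≠ l} → V) :
    IsRootedCopy T G r v ((Equiv.funSplitAt l V).symm (a, ψ)) ↔
      IsRootedCopy (T.induce {u | u ≠ l}) G ⟨r, hrl⟩ v ψ ∧
        (G.Adj (ψ ⟨p, hlp⟩) a ∧ a ∉ Set.range ψ) := by
  have hl' : ∀ w, T.Adj w l ↔ w = p := fun w => by rw [T.adj_comm, hl]
  have hext : ∀ u (hu : u ≠ l), (Equiv.funSplitAt l V).symm (a, ψ) u = ψ ⟨u, hu⟩ :=
    fun u hu => by simp [Equiv.funSplitAt_symm_apply, hu]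
  have hextl : (Equiv.funSplitAt l V).symm (a, ψ) l = a := by
    simp [Equiv.funSplitAt_symm_apply]
  generalize (Equiv.funSplitAt l V).symm (a, ψ) = φ at hext hextl
  constructor
  · rintro ⟨hinj, hhom, hr⟩
    refine ⟨⟨fun u w h => ?_, fun u w h => ?_, ?_⟩, ?_, ?_⟩
    · exact Subtype.ext (hinj (by rw [hext _ u.2, hext _ w.2]; exact h))
    · have := hhom u w h
      rwa [hext _ u.2, hext _ w.2] at this
    · rw [← hext, hr]
    · rw [← hext, ← hextl]
      exact hhom _ _ ((hl' p).2 rfl)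
    · rintro ⟨u, hu⟩
      rw [← hextl, ← hext _ u.2] at hu
      exact u.2 (hinj hu)
  · rintro ⟨⟨hinj, hhom, hr⟩, hadj, hran⟩
    refine ⟨fun u w h => ?_, fun u w h => ?_, ?_⟩
    · by_cases hu : u = l <;> by_cases hw : w = l
      · rw [hu, hw]
      · rw [hu, hextl, hext w hw] at h
        exact (hran ⟨_, h.symm⟩).elim
      · rw [hw, hextl, hext u hu] at h
        exact (hran ⟨_, h⟩).elim
      · rw [hext u hu, hext w hw] at h
        exact congrArg Subtype.val (hinj h)
    · by_cases hu : u = l <;> by_cases hw : w = l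
      · exact (T.irrefl (hu.trans hw.symm ▸ h)).elim
      · subst hu
        obtain rfl := (hl w).1 h
        rw [hextl, hext w hw]
        exact hadj.symm
      · subst hw
        obtain rfl := (hl' u).1 h
        rw [hextl, hext u hu]
        exact hadj
      · rw [hext u hu, hext w hw]
        exact hhom ⟨u, hu⟩ ⟨w, hw⟩ h
    · rw [hext r hrl, hr]

end Leaf

theorem degree_add_one_le_card_adj_notMem_range_add {S V : Type*} [Fintype S] [Fintype V]
    (G : SimpleGraph V) [DecidableRel G.Adj] (ψ : S → V) (p : S)
    [DecidablePred fun a => G.Adj (ψ p) a ∧ a ∉ Set.range ψ] :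
    G.degree (ψ p) + 1 ≤
      (Finset.univ.filter fun a => G.Adj (ψ p) a ∧ a ∉ Set.range ψ).card + Fintype.card S := by
  classical
  have h1 : insert (ψ p) (G.neighborFinset (ψ p)) ⊆
      (Finset.univ.filter fun a => G.Adj (ψ p) a ∧ a ∉ Set.range ψ) ∪ Finset.univ.image ψ := by
    intro a ha
    by_cases h : a ∈ Set.range ψ
    · simpa using Or.inr h
    · rcases Finset.mem_insert.1 ha with rfl | ha
      · exact (h ⟨p, rfl⟩).elim
      · have hadj : G.Adj (ψ p) a := by simpa using ha
        exact Finset.mem_union_left _ (by simpa using ⟨hadj, by simpa using h⟩)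
  have h2 := (Finset.card_le_card h1).trans (Finset.card_union_le _ _)
  rw [Finset.card_insert_of_notMem (by simp), G.card_neighborFinset_eq_degree] at h2
  exact h2.trans (Nat.add_le_add_left (Finset.card_image_le.trans_eq Finset.card_univ) _)

open Classical in
/-- If each value `W a` is at most the number of extensions available at a vertex placed at `a`,
the total weight of the copies rooted at `v` is at least `deg v`, or `W v` for a single-vertex
tree. -/
theorem le_sum_treeWeight {V : Type*} [Fintype V] (G : SimpleGraph V) [DecidableRel G.Adj]
    {W : V → ℝ} (hW : ∀ a, 0 < W a) (v : V) (n : ℕ) (hn : ∀ a, W a + n ≤ G.degree a + 1) :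
    ∀ {U : Type*} [Fintype U] [DecidableEq U] (T : SimpleGraph U) (_ : T.IsTree)
      (_ : Fintype.card U = n + 1) (r : U), (if n = 0 then W v else G.degree v) ≤
        ∑ φ : U → V, if IsRootedCopy T G r v φ then treeWeight T W φ else 0 := by
  induction n with
  | zero =>
    intro U _ _ T hT hcard r
    have : Subsingleton U := Fintype.card_le_one_iff_subsingleton.1 hcard.le
    have hnadj : ∀ u w, ¬ T.Adj u w := fun u w h => h.ne (Subsingleton.elim _ _)
    have hcopy : IsRootedCopy T G r v fun _ => v :=
      ⟨Function.injective_of_subsingleton _, fun u w h => (hnadj u w h).elim, rfl⟩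
    have hnonneg : ∀ φ ∈ (Finset.univ : Finset (U → V)),
        0 ≤ if IsRootedCopy T G r v φ then treeWeight T W φ else 0 := fun φ _ => by
      split_ifs
      · exact (treeWeight_pos T hW φ).le
      · exact le_rfl
    refine le_trans (le_of_eq ?_)
      (Finset.single_le_sum hnonneg (Finset.mem_univ fun _ => v))
    simp [hcopy, treeWeight, hnadj, hcard]
  | succ n ih =>
    intro U _ _ T hT hcard r
    have : Nontrivial U := Fintype.one_lt_card_iff_nontrivial.1 (by omega)
    obtain ⟨l, hrl, hdeg⟩ : ∃ l, r ≠ l ∧ T.degree l = 1 := by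
      obtain ⟨a, b, hab, ha, hb⟩ := hT.exists_ne_and_degree_eq_one
      by_cases h : r = a
      · exact ⟨b, h ▸ hab, hb⟩
      · exact ⟨a, h, ha⟩
    obtain ⟨p, hp, hpu⟩ := SimpleGraph.degree_eq_one_iff_existsUnique_adj.1 hdeg
    have hl : ∀ w, T.Adj l w ↔ w = p := fun w => ⟨hpu w, fun h => h ▸ hp⟩
    have hlp : p ≠ l := hp.ne'
    have hT' : (T.induce {u | u ≠ l}).IsTree :=
      ⟨hT.connected.induce_compl_singleton_of_degree_eq_one hdeg, hT.isAcyclic.induce _⟩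
    have hcard' : Fintype.card {u // u ≠ l} = n + 1 := by
      rw [Fintype.card_subtype_compl, Fintype.card_subtype_eq, hcard]; rfl
    have hn' : ∀ a, W a + (n : ℝ) ≤ G.degree a + 1 := fun a => by
      have := hn a
      push_cast at this
      linarith
    have key := ih hn' (U := {u // u ≠ l}) (T.induce {u | u ≠ l}) hT' hcard' ⟨r, hrl⟩
    rw [if_neg (Nat.succ_ne_zero n), ← (Equiv.funSplitAt l V).symm.sum_comp,
      Fintype.sum_prod_type_right]
    have hcount : ∀ ψ : {u // u ≠ l} → V, ((G.degree (ψ ⟨p, hlp⟩) : ℝ) - n) ≤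
        (Finset.univ.filter fun a => G.Adj (ψ ⟨p, hlp⟩) a ∧ a ∉ Set.range ψ).card := fun ψ => by
      have := degree_add_one_le_card_adj_notMem_range_add G ψ ⟨p, hlp⟩
      rw [hcard'] at this
      have : ((G.degree (ψ ⟨p, hlp⟩) : ℝ) + 1) ≤
        (Finset.univ.filter fun a => G.Adj (ψ ⟨p, hlp⟩) a ∧ a ∉ Set.range ψ).card + (n + 1) := by
        exact_mod_cast this
      linarith
    have hinner : ∀ ψ : {u // u ≠ l} → V,
        (∑ a, if IsRootedCopy T G r v ((Equiv.funSplitAt l V).symm (a, ψ)) then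
          treeWeight T W ((Equiv.funSplitAt l V).symm (a, ψ)) else 0) =
        (if IsRootedCopy (T.induce {u | u ≠ l}) G ⟨r, hrl⟩ v ψ then
          treeWeight (T.induce {u | u ≠ l}) W ψ else 0) * ((W (ψ ⟨p, hlp⟩))⁻¹ *
          (Finset.univ.filter fun a => G.Adj (ψ ⟨p, hlp⟩) a ∧ a ∉ Set.range ψ).card) := by
      intro ψ
      simp only [isRootedCopy_extend_leaf hlp hrl hl, treeWeight_extend_leaf hW hlp hl]
      by_cases h : IsRootedCopy (T.induce {u | u ≠ l}) G ⟨r, hrl⟩ v ψ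
      · simp only [h, true_and, if_true]
        rw [← Finset.sum_filter, Finset.sum_const, nsmul_eq_mul]
        ring
      · simp [h]
    simp only [hinner]
    by_cases h0 : n = 0
    · subst h0
      have hpr : p = r := by
        have : Subsingleton {u // u ≠ l} := Fintype.card_le_one_iff_subsingleton.1 hcard'.le
        exact congrArg Subtype.val (Subsingleton.elim (⟨p, hlp⟩ : {u // u ≠ l}) ⟨r, hrl⟩)
      subst hpr
      rw [if_pos rfl] at key
      have hv := hW v
      calc (G.degree v : ℝ) = W v * ((W v)⁻¹ * G.degree v) := by field_simp
        _ ≤ _ := mul_le_mul_of_nonneg_right key (by positivity)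
        _ ≤ _ := by
          rw [Finset.sum_mul]
          refine Finset.sum_le_sum fun ψ _ => ?_
          split_ifs with h
          · have hle := hcount ψ
            rw [h.2.2, Nat.cast_zero, sub_zero] at hle
            rw [h.2.2]
            exact mul_le_mul_of_nonneg_left (mul_le_mul_of_nonneg_left hle (inv_pos.2 hv).le)
              (treeWeight_pos _ hW ψ).le
          · simp
    · rw [if_neg h0] at key
      refine key.trans (Finset.sum_le_sum fun ψ _ => ?_)
      split_ifs with h
      · refine le_mul_of_one_le_right (treeWeight_pos _ hW ψ).le ?_
        rw [← div_eq_inv_mul, one_le_div (hW _)]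
        have h1 := hn (ψ ⟨p, hlp⟩)
        have h2 := hcount ψ
        push_cast at h1
        linarith
      · simp

/-- In an ordering with parent function `f`, only the vertices `x j` with `j ≥ 2` contribute,
through their parents, to the weight of the tree. -/
theorem treeWeight_eq_prod_parent {U V : Type*} [Fintype U] (T : SimpleGraph U) {t : ℕ}
    (ht : 1 ≤ t) (x : Fin (t + 1) → U) (f : Fin (t + 1) → Fin (t + 1))
    (hx : Function.Bijective x)
    (hf : ∀ j : Fin (t + 1), j ≠ 0 →
      f j < j ∧ T.Adj (x j) (x (f j)) ∧ ∀ k : Fin (t + 1), k < j → T.Adj (x j) (x k) → k = f j)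
    {W : V → ℝ} (hW : ∀ a, 0 < W a) (φ : U → V) :
    treeWeight T W φ =
      ∏ j ∈ Finset.univ.filter (fun j : Fin (t + 1) => 2 ≤ (j : ℕ)), (W (φ (x (f j))))⁻¹ := by
  classical
  obtain ⟨t, rfl⟩ : ∃ s, t = s + 1 := ⟨t - 1, by omega⟩
  have hpair : ∀ j k, (if T.Adj (x j) (x k) then (W (φ (x j)))⁻¹ else 1) =
      (if j ≠ 0 ∧ k = f j then (W (φ (x j)))⁻¹ else 1) *
        (if k ≠ 0 ∧ j = f k then (W (φ (x j)))⁻¹ else 1) := by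
    intro j k
    rcases lt_trichotomy j k with h | h | h
    · have hk : k ≠ 0 := (Fin.zero_le j |>.trans_lt h).ne'
      have h1 : ¬ (j ≠ 0 ∧ k = f j) := fun ⟨hj, e⟩ =>
        absurd (hf j hj).1 (by rw [← e]; exact h.asymm)
      have h2 : T.Adj (x j) (x k) ↔ k ≠ 0 ∧ j = f k :=
        ⟨fun e => ⟨hk, (hf k hk).2.2 j h e.symm⟩, fun e => e.2 ▸ (hf k hk).2.1.symm⟩
      simp only [h1, h2, if_false, one_mul]
    · subst h
      have h1 : ¬ (j ≠ 0 ∧ j = f j) := fun ⟨hj, e⟩ => (hf j hj).1.ne e.symm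
      simp only [h1, SimpleGraph.irrefl, if_false, one_mul]
    · have hj : j ≠ 0 := (Fin.zero_le k |>.trans_lt h).ne'
      have h1 : ¬ (k ≠ 0 ∧ j = f k) := fun ⟨hk, e⟩ =>
        absurd (hf k hk).1 (by rw [← e]; exact h.asymm)
      have h2 : T.Adj (x j) (x k) ↔ j ≠ 0 ∧ k = f j :=
        ⟨fun e => ⟨hj, (hf j hj).2.2 k h e⟩, fun e => e.2 ▸ (hf j hj).2.1⟩
      simp only [h1, h2, if_false, mul_one]
  have hleft : ∀ j, (∏ k, if j ≠ 0 ∧ k = f j then (W (φ (x j)))⁻¹ else 1) =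
      if j ≠ 0 then (W (φ (x j)))⁻¹ else 1 := fun j => by
    by_cases hj : j = 0 <;> simp [hj]
  have hright : ∀ k, (∏ j, if k ≠ 0 ∧ j = f k then (W (φ (x j)))⁻¹ else 1) =
      if k ≠ 0 then (W (φ (x (f k))))⁻¹ else 1 := fun k => by
    by_cases hk : k = 0 <;> simp [hk]
  have hf1 : f 1 = 0 := by
    have := (hf 1 (by simp)).1
    exact Fin.lt_one_iff _ |>.1 this
  have hreindex : treeWeight T W φ = (∏ j, W (φ (x j))) *
      ∏ j, ∏ k, if T.Adj (x j) (x k) then (W (φ (x j)))⁻¹ else 1 := by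
    unfold treeWeight
    rw [← hx.prod_comp, ← hx.prod_comp fun u => ∏ w, if T.Adj u w then (W (φ u))⁻¹ else 1]
    congr 1
    refine Finset.prod_congr rfl fun j _ => ?_
    rw [← hx.prod_comp]
  rw [hreindex]
  simp only [hpair, Finset.prod_mul_distrib, hleft]
  rw [Finset.prod_comm (f := fun j k => if k ≠ 0 ∧ j = f k then (W (φ (x j)))⁻¹ else 1)]
  simp only [hright]
  rw [← mul_assoc, ← Finset.prod_mul_distrib, Finset.prod_filter]
  have hself : ∀ j, (W (φ (x j)) * if j ≠ 0 then (W (φ (x j)))⁻¹ else 1) =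
      if j = 0 then W (φ (x 0)) else 1 := fun j => by
    by_cases hj : j = 0
    · simp [hj]
    · simp [hj, (hW (φ (x j))).ne']
  simp only [hself, Finset.prod_ite_eq', Finset.mem_univ, if_true]
  rw [Fin.prod_univ_succ, Fin.prod_univ_succ, Fin.prod_univ_succ (n := t + 1),
    Fin.prod_univ_succ (n := t)]
  simp [hf1, (hW (φ (x 0))).ne']

/-- Let `T` be a tree with `t ≥ 1` edges, with vertices ordered in a good
labeling `x 0, x 1, …, x t` (0-indexed version of `x_1, …, x_{t+1}`) with parent function
`f` : thus `x 0` is a leaf, and for each `j ≠ 0`, `f j` is the unique index with `f j < j`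
and `x j ~ x (f j)` in `T`. Let `G` be a finite graph with minimum degree at least `t`, and
let `Ω` be the set of labeled copies of `T` in `G`. Then for every vertex `v` of `G` and
every index `i`,
`∑_{φ ∈ Ω, φ(x i) = v} ∏_{j=2}^{t} (d(φ(x (f j))) − t + 1)⁻¹ ≥ d(v)`
(the product over the 0-indexed `j ∈ {2, …, t}` corresponds to the paper's product
`∏_{j=2}^{t} (d(φ(x_{f(j+1)})) − t + 1)⁻¹`). -/
theorem sum_over_copies_ge_degree {VT V : Type*} [Fintype VT] [DecidableEq VT]
    [Fintype V] [DecidableEq V]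
    (T : SimpleGraph VT) [DecidableRel T.Adj] (G : SimpleGraph V) [DecidableRel G.Adj]
    (t : ℕ) (ht : 1 ≤ t) (hT : T.IsTree) (hTedges : T.edgeFinset.card = t)
    (x : Fin (t + 1) → VT) (f : Fin (t + 1) → Fin (t + 1))
    (hx : Function.Bijective x) (hleaf : T.degree (x 0) = 1)
    (hf : ∀ j : Fin (t + 1), j ≠ 0 →
      f j < j ∧ T.Adj (x j) (x (f j)) ∧ ∀ k : Fin (t + 1), k < j → T.Adj (x j) (x k) → k = f j)
    (hmin : ∀ v : V, t ≤ G.degree v)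
    (v : V) (i : Fin (t + 1)) :
    (G.degree v : ℝ) ≤
      ∑ φ ∈ Finset.univ.filter (fun φ : VT → V => Function.Injective φ ∧
          (∀ u w : VT, T.Adj u w → G.Adj (φ u) (φ w)) ∧ φ (x i) = v),
        ∏ j ∈ Finset.univ.filter (fun j : Fin (t + 1) => 2 ≤ (j : ℕ)),
          ((G.degree (φ (x (f j))) : ℝ) - (t : ℝ) + 1)⁻¹ := by
  classical
  have hcard : Fintype.card VT = t + 1 := by
    rw [← Fintype.card_of_bijective hx, Fintype.card_fin]
  have hW : ∀ a, 0 < (G.degree a : ℝ) - (t : ℝ) + 1 := fun a => by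
    have : (t : ℝ) ≤ G.degree a := by exact_mod_cast hmin a
    linarith
  have key := le_sum_treeWeight G hW v t (fun a => by linarith) T hT hcard (x i)
  rw [if_neg (by omega)] at key
  rw [Finset.sum_filter]
  refine key.trans_eq (Finset.sum_congr rfl fun φ _ => ?_)
  rw [treeWeight_eq_prod_parent T ht x f hx hf hW φ]
  exact if_congr Iff.rfl rfl rfl
end

section
/- Let T be a tree with t ≥ 1 edges, with vertices ordered in a good labeling x_1, x_2, …, x_{t+1} with parent function f. Let G = (V,E) be a finite graph with minimum degree at least t, and let Ω be the set of labeled copies of T in G. Then ∑_{φ ∈ Ω} ∏_{i=2}^{t} |N(φ(x_{f(i+1)})) \ {φ(x_1), φ(x_2), …, φ(x_i)}|^{−1} = 2|E|, where N(w) denotes the neighborhood of w in G. In particular, each cardinality appearing in the product is positive. -/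
namespace SimpleGraph

variable {V : Type*} [Fintype V] (G : SimpleGraph V) [DecidableRel G.Adj]

theorem sum_ite_adj_eq_two_mul_card_edgeFinset :
    ∑ v, ∑ w, (if G.Adj v w then (1 : ℝ) else 0) = 2 * G.edgeFinset.card := by
  simp only [Finset.sum_boole]
  have h := G.sum_degrees_eq_twice_card_edges
  simp only [← card_neighborFinset_eq_degree, neighborFinset_eq_filter] at h
  exact_mod_cast h

variable [DecidableEq V]

theorem card_neighborFinset_sdiff_pos {v : V} {S : Finset V} (hv : v ∈ S)
    (hS : S.card ≤ G.degree v) : 0 < (G.neighborFinset v \ S).card := by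
  have h : G.neighborFinset v \ S = G.neighborFinset v \ S.erase v := by
    ext w
    simp only [Finset.mem_sdiff, mem_neighborFinset, Finset.mem_erase, not_and]
    exact and_congr_right fun h => ⟨fun h1 _ => h1, fun h1 => h1 h.ne'⟩
  have h1 := Finset.le_card_sdiff (S.erase v) (G.neighborFinset v)
  rw [Finset.card_erase_of_mem hv, card_neighborFinset_eq_degree] at h1
  have h2 := Finset.card_pos.2 ⟨v, hv⟩
  rw [h]
  omega

/-- The possible images of the vertex `j` once the vertices before `j` have been embedded. -/
def extensionFinset {n : ℕ} (f : Fin n → Fin n) (ψ : Fin n → V) (j : Fin n) : Finset V :=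
  G.neighborFinset (ψ (f j)) \
    (Finset.univ.filter (fun k : Fin n => (k : ℕ) < (j : ℕ))).image (fun k => ψ k)

theorem card_extensionFinset_pos {n t : ℕ} (hn : n ≤ t + 1) (hmin : ∀ v : V, t ≤ G.degree v)
    (f : Fin n → Fin n) (ψ : Fin n → V) (j : Fin n) (hj : f j < j) :
    0 < (G.extensionFinset f ψ j).card := by
  refine G.card_neighborFinset_sdiff_pos (Finset.mem_image.2 ⟨f j, by simpa using hj, rfl⟩) ?_
  refine Finset.card_image_le.trans (le_trans ?_ (hmin _))
  rw [Fin.card_filter_val_lt]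
  omega

/-- A tuple of distinct vertices in which each entry but the first is adjacent to its parent. -/
def IsTreeTuple {n : ℕ} (f : Fin (n + 1) → Fin (n + 1)) (ψ : Fin (n + 1) → V) : Prop :=
  Function.Injective ψ ∧ ∀ j, j ≠ 0 → G.Adj (ψ j) (ψ (f j))

section Snoc

variable {G} {n : ℕ} {f : Fin (n + 2) → Fin (n + 2)} {g : Fin (n + 1) → Fin (n + 1)}

theorem extensionFinset_snoc_castSucc (ψ : Fin (n + 1) → V) (v : V) {j : Fin (n + 1)}
    (hg : f j.castSucc = (g j).castSucc) :
    G.extensionFinset f (Fin.snoc ψ v : Fin (n + 2) → V) j.castSucc = G.extensionFinset g ψ j := by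
  unfold extensionFinset
  rw [hg, Fin.snoc_castSucc (α := fun _ => V)]
  congr 1
  ext w
  simp only [Finset.mem_image, Finset.mem_filter, Finset.mem_univ, true_and, Fin.exists_fin_succ',
    Fin.snoc_castSucc (α := fun _ => V), Fin.val_castSucc, Fin.val_last]
  constructor
  · rintro (h | h)
    · exact h
    · omega
  · exact Or.inl

theorem extensionFinset_snoc_last (ψ : Fin (n + 1) → V) (v : V) {k : Fin (n + 1)}
    (hk : f (Fin.last _) = k.castSucc) :
    G.extensionFinset f (Fin.snoc ψ v : Fin (n + 2) → V) (Fin.last _) =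
      G.neighborFinset (ψ k) \ Finset.univ.image ψ := by
  unfold extensionFinset
  rw [hk, Fin.snoc_castSucc (α := fun _ => V)]
  congr 1
  ext w
  simp only [Finset.mem_image, Finset.mem_filter, Finset.mem_univ, true_and, Fin.exists_fin_succ',
    Fin.snoc_castSucc (α := fun _ => V), Fin.val_castSucc, Fin.val_last, lt_irrefl, false_and,
    or_false]
  simp

theorem isTreeTuple_snoc (hg : ∀ j, j ≠ 0 → f j.castSucc = (g j).castSucc)
    (ψ : Fin (n + 1) → V) (v : V) {k : Fin (n + 1)} (hk : f (Fin.last _) = k.castSucc) :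
    G.IsTreeTuple f (Fin.snoc ψ v : Fin (n + 2) → V) ↔
      G.IsTreeTuple g ψ ∧ v ∈ G.neighborFinset (ψ k) \ Finset.univ.image ψ := by
  have h0 : Fin.last (n + 1) ≠ 0 := Fin.last_pos.ne'
  have hadj : (∀ j : Fin (n + 1), j.castSucc ≠ 0 →
      G.Adj (ψ j) ((Fin.snoc ψ v : Fin (n + 2) → V) (f j.castSucc))) ↔
      ∀ j, j ≠ 0 → G.Adj (ψ j) (ψ (g j)) := by
    refine forall_congr' fun j => ?_
    rw [Ne, Fin.castSucc_eq_zero_iff]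
    refine imp_congr_right fun hj => ?_
    rw [hg j hj, Fin.snoc_castSucc (α := fun _ => V)]
  unfold IsTreeTuple
  rw [Fin.snoc_injective_iff, Fin.forall_fin_succ', hk]
  simp only [Fin.snoc_castSucc (α := fun _ => V), Fin.snoc_last, hadj, h0, ne_eq,
    not_false_eq_true, forall_const, Finset.mem_sdiff, mem_neighborFinset, Finset.mem_image,
    Finset.mem_univ, true_and, Set.mem_range, G.adj_comm v]
  tauto

end Snoc

open Classical in
theorem sum_isTreeTuple {t : ℕ} (hmin : ∀ v : V, t ≤ G.degree v) (n : ℕ) (hn : n + 1 ≤ t)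
    (f : Fin (n + 2) → Fin (n + 2)) (hf : ∀ j, j ≠ 0 → f j < j) :
    ∑ ψ : Fin (n + 2) → V, (if G.IsTreeTuple f ψ then
      ∏ j : Fin (n + 2), (if 2 ≤ (j : ℕ) then ((G.extensionFinset f ψ j).card : ℝ)⁻¹ else 1)
      else 0) = 2 * G.edgeFinset.card := by
  induction n with
  | zero =>
    rw [← G.sum_ite_adj_eq_two_mul_card_edgeFinset, ← Fintype.sum_prod_type',
      ← (finTwoArrowEquiv V).sum_comp]
    refine Finset.sum_congr rfl fun ψ _ => ?_
    have h1 : f 1 = 0 := Fin.lt_one_iff _ |>.1 (hf 1 (by simp))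
    have h : G.IsTreeTuple f ψ ↔ G.Adj (ψ 0) (ψ 1) := by
      refine ⟨fun h => ?_, fun h => ⟨?_, ?_⟩⟩
      · have := h.2 1 (by simp)
        rw [h1] at this
        exact this.symm
      · intro a b hab
        fin_cases a <;> fin_cases b <;> simp_all [h.ne, h.ne']
      · intro j hj
        fin_cases j
        · simp at hj
        · simpa [h1] using h.symm
    simp [h]
  | succ n ih =>
    have hex : ∀ j : Fin (n + 2), ∃ i : Fin (n + 2), j ≠ 0 → f j.castSucc = i.castSucc := by
      intro j
      by_cases hj : j = 0
      · exact ⟨0, fun h => absurd hj h⟩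
      · have h := hf j.castSucc (by simpa using hj)
        obtain ⟨i, hi⟩ := Fin.exists_castSucc_eq.2 (h.trans (Fin.castSucc_lt_last j)).ne
        exact ⟨i, fun _ => hi.symm⟩
    choose g hg using hex
    have hfl := hf (Fin.last (n + 2)) Fin.last_pos.ne'
    obtain ⟨k, hk⟩ := Fin.exists_castSucc_eq.2 hfl.ne
    replace hk := hk.symm
    rw [← ih (by omega) g fun j hj => by
      have h := hf j.castSucc (by simpa using hj)
      rwa [hg j hj, Fin.castSucc_lt_castSucc_iff] at h]
    rw [← (Fin.snocEquiv fun _ : Fin (n + 3) => V).sum_comp, Fintype.sum_prod_type_right]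
    refine Finset.sum_congr rfl fun ψ _ => ?_
    simp only [Fin.snocEquiv, Equiv.coe_fn_mk, isTreeTuple_snoc hg _ _ hk]
    by_cases hψ : G.IsTreeTuple g ψ
    swap
    · simp [hψ]
    obtain ⟨v₀⟩ : Nonempty V := ⟨ψ 0⟩
    have hpos := G.card_extensionFinset_pos (by omega) hmin f (Fin.snoc ψ v₀) _ hfl
    rw [extensionFinset_snoc_last ψ v₀ hk] at hpos
    simp only [hψ, true_and, if_true, extensionFinset_snoc_last ψ _ hk,
      Fin.prod_univ_castSucc (n := n + 2), ← Finset.sum_filter, Finset.filter_univ_mem]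
    rw [Finset.sum_congr rfl fun v _ => congrArg₂ (· * ·)
      (Finset.prod_congr rfl fun (j : Fin (n + 2)) _ =>
        show _ = (if 2 ≤ (j : ℕ) then ((G.extensionFinset g ψ j).card : ℝ)⁻¹ else 1) from ?_) rfl]
    · rw [Finset.sum_const, nsmul_eq_mul]
      simp only [Fin.val_last, le_add_iff_nonneg_left, zero_le, if_true]
      field_simp
    · by_cases hj : 2 ≤ (j : ℕ)
      · rw [extensionFinset_snoc_castSucc ψ v (hg j (by rintro rfl; simp at hj))]
        simp
      · simp [hj]

end SimpleGraph

/-- Let `T` be a tree with `t ≥ 1` edges, with vertices ordered in a good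
labeling `x 0, x 1, …, x t` (0-indexed version of `x_1, …, x_{t+1}`) with parent function
`f`. Let `G = (V, E)` be a finite graph with minimum degree at least `t`, and let `Ω` be the
set of labeled copies of `T` in `G`. Then
`∑_{φ ∈ Ω} ∏_{i=2}^{t} |N(φ(x_{f(i+1)})) \ {φ(x_1), …, φ(x_i)}|⁻¹ = 2|E|`,
where `N(w)` denotes the neighborhood of `w` in `G`; in particular each cardinality appearing
in the product is positive. (In the 0-indexed product below, the index `j ∈ {2, …, t}`
corresponds to the paper's `i`, `f j` corresponds to `f(i+1)`, and the removed set
`{φ(x k) : k < j}` corresponds to `{φ(x_1), …, φ(x_i)}`.) -/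
theorem sum_over_copies_eq_two_mul_edges {VT V : Type*} [Fintype VT] [DecidableEq VT]
    [Fintype V] [DecidableEq V]
    (T : SimpleGraph VT) [DecidableRel T.Adj] (G : SimpleGraph V) [DecidableRel G.Adj]
    (t : ℕ) (ht : 1 ≤ t) (hT : T.IsTree) (hTedges : T.edgeFinset.card = t)
    (x : Fin (t + 1) → VT) (f : Fin (t + 1) → Fin (t + 1))
    (hx : Function.Bijective x) (hleaf : T.degree (x 0) = 1)
    (hf : ∀ j : Fin (t + 1), j ≠ 0 →
      f j < j ∧ T.Adj (x j) (x (f j)) ∧ ∀ k : Fin (t + 1), k < j → T.Adj (x j) (x k) → k = f j)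
    (hmin : ∀ v : V, t ≤ G.degree v) :
    (∑ φ ∈ Finset.univ.filter (fun φ : VT → V => Function.Injective φ ∧
          ∀ u w : VT, T.Adj u w → G.Adj (φ u) (φ w)),
        ∏ j ∈ Finset.univ.filter (fun j : Fin (t + 1) => 2 ≤ (j : ℕ)),
          (((G.neighborFinset (φ (x (f j))) \
              (Finset.univ.filter (fun k : Fin (t + 1) => (k : ℕ) < (j : ℕ))).image
                (fun k => φ (x k))).card : ℝ))⁻¹) = 2 * G.edgeFinset.card ∧
    ∀ φ ∈ Finset.univ.filter (fun φ : VT → V => Function.Injective φ ∧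
        ∀ u w : VT, T.Adj u w → G.Adj (φ u) (φ w)),
      ∀ j : Fin (t + 1), 2 ≤ (j : ℕ) →
        0 < (G.neighborFinset (φ (x (f j))) \
              (Finset.univ.filter (fun k : Fin (t + 1) => (k : ℕ) < (j : ℕ))).image
                (fun k => φ (x k))).card := by
  have hT' : ∀ φ : VT → V, (Function.Injective φ ∧ ∀ u w : VT, T.Adj u w → G.Adj (φ u) (φ w)) ↔
      G.IsTreeTuple f (φ ∘ x) := by
    intro φ
    refine and_congr (Function.Injective.of_comp_iff' φ hx).symm
      ⟨fun h j hj => h _ _ (hf j hj).2.1, ?_⟩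
    intro h u w huw
    obtain ⟨a, rfl⟩ := hx.2 u
    obtain ⟨b, rfl⟩ := hx.2 w
    rcases lt_trichotomy a b with hab | rfl | hab
    · have hb : b ≠ 0 := (lt_of_le_of_lt (Fin.zero_le _) hab).ne'
      rw [(hf b hb).2.2 a hab huw.symm]
      exact (h b hb).symm
    · exact absurd huw (T.loopless.irrefl _)
    · have ha : a ≠ 0 := (lt_of_le_of_lt (Fin.zero_le _) hab).ne'
      rw [(hf a ha).2.2 b hab huw]
      exact h a ha
  constructor
  · obtain ⟨n, rfl⟩ := Nat.exists_eq_add_of_le' ht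
    let e := Equiv.ofBijective x hx
    rw [← G.sum_isTreeTuple hmin n le_rfl f fun j hj => (hf j hj).1, Finset.sum_filter,
      ← (e.arrowCongr (Equiv.refl V)).sum_comp]
    refine Finset.sum_congr rfl fun ψ _ => ?_
    have hψ : e.arrowCongr (Equiv.refl V) ψ ∘ x = ψ := by
      ext j
      exact congrArg ψ (e.symm_apply_apply j)
    classical
    refine if_congr ((hT' _).trans (by rw [hψ])) ?_ rfl
    rw [Finset.prod_filter]
    exact congrArg (fun χ : Fin (n + 2) → V => ∏ j : Fin (n + 2),
      if 2 ≤ (j : ℕ) then ((G.extensionFinset f χ j).card : ℝ)⁻¹ else 1) hψ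
  · intro φ _ j hj
    exact G.card_extensionFinset_pos le_rfl hmin f (φ ∘ x) j
      (hf j (by rintro rfl; simp at hj)).1
end
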